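/- Let γ denote the Euler–Mascheroni constant. For every ρ_0 ∈ (0,1) and λ_1 > 0 there exist constants C > 0 and T_0 ≥ e^{1-γ} e^{2/ρ_0} depending only on ρ_0 and λ_1 such that for all t_0 ≥ T_0, all λ ≥ λ_1, and all ρ ∈ [ρ_0, 1), the function e_λ(ρ) = t_0^{ρ-1} E_{ρ,ρ}(-λ t_0^ρ) is differentiable at ρ and (d/dρ) e_λ(ρ) ≤ -1/(λ² t_0^{ρ+1}) + C (1/ρ + ln t_0) / (λ³ t_0^{2ρ+1}); consequently, if in addition t_0^{ρ_0} > (C/λ_1)(1/ρ_0 + ln t_0), then (d/dρ) e_λ(ρ) < 0 for all ρ ∈ [ρ_0, 1). -/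

import Mathlib

/-- The two-parameter Mittag-Leffler function `E_{ρ,μ}(x) = Σ_{k=0}^∞ x^k / Γ(ρk + μ)`
(real argument). -/
noncomputable def mittagLeffler (ρ μ x : ℝ) : ℝ :=
  ∑' k : ℕ, x ^ k / Real.Gamma (ρ * k + μ)

open MeasureTheory Set Filter Topology

lemma ml_integrable_exp (κ a : ℝ) (hκ : 0 < κ) (ha : 0 < a) :
    Integrable (fun u : ℝ => Real.exp (-κ * Real.exp u + a * u)) := by
  have h := integrableOn_rpow_mul_exp_neg_mul_rpow (p := 1) (s := a - 1) (b := κ)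
    (by linarith) one_pos hκ
  have him : Real.exp '' univ = Ioi 0 := by rw [image_univ, Real.range_exp]
  rw [← him, integrableOn_image_iff_integrableOn_abs_deriv_smul MeasurableSet.univ
    (fun x _ => (Real.hasDerivAt_exp x).hasDerivWithinAt) Real.exp_injective.injOn,
    integrableOn_univ] at h
  refine h.congr (Eventually.of_forall fun u => ?_)
  simp only [Real.rpow_one, smul_eq_mul, abs_of_pos (Real.exp_pos u)]
  rw [← Real.exp_mul, ← mul_assoc, ← Real.exp_add, ← Real.exp_add]
  ring_nf

lemma ml_integral_exp (a : ℝ) (ha : 0 < a) :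
    ∫ u : ℝ, Real.exp (-Real.exp u + a * u) = Real.Gamma a := by
  have him : Real.exp '' univ = Ioi 0 := by rw [image_univ, Real.range_exp]
  rw [Real.Gamma_eq_integral ha, ← him,
    integral_image_eq_integral_abs_deriv_smul MeasurableSet.univ
    (fun x _ => (Real.hasDerivAt_exp x).hasDerivWithinAt) Real.exp_injective.injOn,
    setIntegral_univ]
  refine integral_congr_ae (Eventually.of_forall fun u => ?_)
  simp only [smul_eq_mul, abs_of_pos (Real.exp_pos u)]
  rw [← Real.exp_mul, ← Real.exp_add, ← Real.exp_add]
  ring_nf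

lemma ml_norm (c u v : ℝ) :
    ‖Complex.exp (Complex.exp (u + v * Complex.I) + c * (u + v * Complex.I))‖ =
      Real.exp (Real.cos v * Real.exp u + c * u) := by
  rw [Complex.norm_exp]
  congr 1
  simp [Complex.exp_re]
  ring

lemma ml_norm_neg (c u v : ℝ) :
    ‖Complex.exp (-Complex.exp (u + v * Complex.I) + c * (u + v * Complex.I))‖ =
      Real.exp (-Real.cos v * Real.exp u + c * u) := by
  rw [Complex.norm_exp]
  congr 1
  simp [Complex.exp_re]
  ring

/-- `exp (-κ e^u + c u) → 0` at `+∞`. -/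
lemma ml_tendsto_top (κ c : ℝ) (hκ : 0 < κ) :
    Tendsto (fun u : ℝ => Real.exp (-κ * Real.exp u + c * u)) atTop (𝓝 0) := by
  have h := tendsto_rpow_mul_exp_neg_mul_atTop_nhds_zero c κ hκ
  refine (h.comp Real.tendsto_exp_atTop).congr fun u => ?_
  simp only [Function.comp]
  rw [← Real.exp_mul, ← Real.exp_add]; ring_nf

lemma ml_tendsto_bot (κ c : ℝ) (hc : 0 < c) :
    Tendsto (fun u : ℝ => Real.exp (κ * Real.exp u + c * u)) atBot (𝓝 0) := by
  have h1 : Tendsto (fun u : ℝ => Real.exp (κ * Real.exp u)) atBot (𝓝 (Real.exp (κ * 0))) :=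
    (Real.continuous_exp.tendsto _).comp (Real.tendsto_exp_atBot.const_mul κ)
  have h2 : Tendsto (fun u : ℝ => Real.exp (c * u)) atBot (𝓝 0) :=
    Real.tendsto_exp_atBot.comp (tendsto_id.const_mul_atBot hc)
  simpa [Real.exp_add] using h1.mul h2

/-- Shifting a full-line integral in the strip. -/
lemma ml_shift (Φ : ℂ → ℂ) (φ : ℝ) (hd : Differentiable ℂ Φ)
    (h0 : Integrable (fun u : ℝ => Φ (u + (0:ℝ) * Complex.I)))
    (h1 : Integrable (fun u : ℝ => Φ (u + φ * Complex.I)))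
    (B : ℝ → ℝ) (hB : ∀ u : ℝ, ∀ v ∈ uIcc 0 φ, ‖Φ (u + v * Complex.I)‖ ≤ B u)
    (hBt : Tendsto B atTop (𝓝 0)) (hBb : Tendsto B atBot (𝓝 0)) :
    ∫ u : ℝ, Φ (u + φ * Complex.I) = ∫ u : ℝ, Φ (u + (0:ℝ) * Complex.I) := by
  have key : ∀ T : ℝ, (∫ x : ℝ in (-T)..T, Φ (x + (0:ℝ) * Complex.I))
      - (∫ x : ℝ in (-T)..T, Φ (x + φ * Complex.I))
      + Complex.I • (∫ y : ℝ in (0:ℝ)..φ, Φ (T + y * Complex.I))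
      - Complex.I • (∫ y : ℝ in (0:ℝ)..φ, Φ ((-T : ℝ) + y * Complex.I)) = 0 := by
    intro T
    have := Complex.integral_boundary_rect_eq_zero_of_differentiableOn Φ (⟨-T, 0⟩ : ℂ) ⟨T, φ⟩
      hd.differentiableOn
    simpa using this
  have hv : ∀ (s : ℝ → ℝ), Tendsto (fun T => B (s T)) atTop (𝓝 0) →
      Tendsto (fun T : ℝ => Complex.I • (∫ y : ℝ in (0:ℝ)..φ, Φ ((s T : ℝ) + y * Complex.I)))
        atTop (𝓝 0) := by
    intro s hs
    refine squeeze_zero_norm (a := fun T => B (s T) * |φ - 0|) (fun T => ?_) (by simpa using hs.mul_const |φ - 0|)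
    rw [norm_smul, Complex.norm_I, one_mul]
    exact intervalIntegral.norm_integral_le_of_norm_le_const
      fun y hy => hB _ _ (uIoc_subset_uIcc hy)
  have l0 := intervalIntegral_tendsto_integral h0 tendsto_neg_atTop_atBot tendsto_id
  have l1 := intervalIntegral_tendsto_integral h1 tendsto_neg_atTop_atBot tendsto_id
  have h := (((l0.sub l1).add (hv id hBt)).sub (hv (fun T => -T) (hBb.comp tendsto_neg_atTop_atBot)))
  have h' := tendsto_nhds_unique h (tendsto_const_nhds.congr fun T => (key T).symm)
  simp only [add_zero, sub_zero] at h'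
  exact (sub_eq_zero.1 h').symm

lemma ml_gamma_line (θ a : ℝ) (h1 : Real.pi / 2 < θ) (h2 : θ < Real.pi) (ha : 0 < a) :
    ∫ u : ℝ, Complex.exp (Complex.exp (u + θ * Complex.I) + a * (u + θ * Complex.I)) =
      Complex.exp (a * Real.pi * Complex.I) * Real.Gamma a := by
  set φ := θ - Real.pi with hφ
  have hcos : 0 < Real.cos φ := Real.cos_pos_of_mem_Ioo ⟨by linarith, by linarith⟩
  have hcv : ∀ v ∈ uIcc 0 φ, Real.cos φ ≤ Real.cos v := by
    intro v hv
    rw [uIcc_of_ge (by linarith)] at hv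
    rw [← Real.cos_neg φ, ← Real.cos_neg v]
    exact Real.cos_le_cos_of_nonneg_of_le_pi (by linarith [hv.2]) (by linarith) (by linarith [hv.1])
  have hs := ml_shift (fun w => Complex.exp (-Complex.exp w + a * w)) φ (by fun_prop)
    (by
      refine (integrable_norm_iff (by fun_prop)).1 ?_
      simp_rw [ml_norm_neg]
      apply ml_integrable_exp _ _ _ ha
      simp)
    (by
      refine (integrable_norm_iff (by fun_prop)).1 ?_
      simp_rw [ml_norm_neg]
      exact ml_integrable_exp _ _ hcos ha)
    (fun u => Real.exp (-Real.cos φ * Real.exp u + a * u))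
    (by
      intro u v hv
      rw [ml_norm_neg]
      have := hcv v hv
      gcongr)
    (ml_tendsto_top _ _ hcos) (ml_tendsto_bot _ _ ha)
  have e1 : ∀ u : ℝ, Complex.exp (Complex.exp (u + θ * Complex.I) + a * (u + θ * Complex.I)) =
      Complex.exp (a * Real.pi * Complex.I) *
        Complex.exp (-Complex.exp (u + φ * Complex.I) + a * (u + φ * Complex.I)) := by
    intro u
    have : Complex.exp (u + θ * Complex.I) = -Complex.exp (u + φ * Complex.I) := by
      have : (u + θ * Complex.I : ℂ) = (u + φ * Complex.I) + Real.pi * Complex.I := by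
        rw [hφ]; push_cast; ring
      rw [this, Complex.exp_add, Complex.exp_pi_mul_I]; ring
    rw [this, ← Complex.exp_add]
    congr 1
    rw [hφ]; push_cast; ring
  simp_rw [e1]
  rw [integral_const_mul, hs, ← ml_integral_exp a ha, ← integral_complex_ofReal]
  congr 1
  refine integral_congr_ae (Eventually.of_forall fun u => ?_)
  simp

noncomputable def mlH (θ x : ℝ) (Φ : ℂ → ℂ) : ℂ :=
  (∫ u : ℝ in Ioi x, Φ (u + θ * Complex.I)) - (∫ u : ℝ in Ioi x, Φ (u + (-θ : ℝ) * Complex.I))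
    + Complex.I * ∫ v : ℝ in (-θ)..θ, Φ (x + v * Complex.I)

lemma mlH_collapse (θ x : ℝ) (hθ : 0 ≤ θ) (Φ : ℂ → ℂ)
    (hd : DifferentiableOn ℂ Φ {w | |w.im| ≤ θ})
    (h0 : Integrable (fun u : ℝ => Φ (u + (-θ : ℝ) * Complex.I)))
    (h1 : Integrable (fun u : ℝ => Φ (u + θ * Complex.I)))
    (B : ℝ → ℝ) (hB : ∀ u : ℝ, ∀ v : ℝ, |v| ≤ θ → ‖Φ (u + v * Complex.I)‖ ≤ B u)
    (hBb : Tendsto B atBot (𝓝 0)) :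
    mlH θ x Φ = (∫ u : ℝ, Φ (u + θ * Complex.I)) - ∫ u : ℝ, Φ (u + (-θ : ℝ) * Complex.I) := by
  have key : ∀ y : ℝ, (∫ u : ℝ in y..x, Φ (u + (-θ : ℝ) * Complex.I))
      - (∫ u : ℝ in y..x, Φ (u + θ * Complex.I))
      + Complex.I • (∫ v : ℝ in (-θ)..θ, Φ (x + v * Complex.I))
      - Complex.I • (∫ v : ℝ in (-θ)..θ, Φ (y + v * Complex.I)) = 0 := by
    intro y
    have := Complex.integral_boundary_rect_eq_zero_of_differentiableOn Φ (⟨y, -θ⟩ : ℂ) ⟨x, θ⟩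
      (hd.mono (by
        intro w hw
        rw [Complex.mem_reProdIm] at hw
        have h := hw.2
        simp only [uIcc_of_le (show -θ ≤ θ by linarith)] at h
        exact abs_le.2 h))
    simpa using this
  have hv : Tendsto (fun y : ℝ => Complex.I • (∫ v : ℝ in (-θ)..θ, Φ (y + v * Complex.I)))
        atBot (𝓝 0) := by
    refine squeeze_zero_norm (a := fun T => B T * |θ - -θ|) (fun T => ?_)
      (by simpa using hBb.mul_const |θ - -θ|)
    rw [norm_smul, Complex.norm_I, one_mul]
    refine intervalIntegral.norm_integral_le_of_norm_le_const fun y hy => hB _ _ ?_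
    have h := uIoc_subset_uIcc hy
    rw [uIcc_of_le (show -θ ≤ θ by linarith)] at h
    exact abs_le.2 h
  have l0 := intervalIntegral_tendsto_integral_Iic x h0.integrableOn tendsto_id
  have l1 := intervalIntegral_tendsto_integral_Iic x h1.integrableOn tendsto_id
  have h := ((l0.sub l1).add_const (Complex.I • (∫ v : ℝ in (-θ)..θ, Φ (x + v * Complex.I)))).sub hv
  have h' := tendsto_nhds_unique h (tendsto_const_nhds.congr fun T => (key T).symm)
  have s0 := intervalIntegral.integral_Iic_add_Ioi (h0.integrableOn (s := Iic x)) (h0.integrableOn (s := Ioi x))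
  have s1 := intervalIntegral.integral_Iic_add_Ioi (h1.integrableOn (s := Iic x)) (h1.integrableOn (s := Ioi x))
  rw [← s0, ← s1, mlH]
  simp only [smul_eq_mul] at h'
  linear_combination h'

lemma ml_conj_line (Φ : ℂ → ℂ) (θ : ℝ)
    (hc : ∀ w, Φ ((starRingEnd ℂ) w) = (starRingEnd ℂ) (Φ w)) :
    ∫ u : ℝ, Φ (u + (-θ : ℝ) * Complex.I) =
      (starRingEnd ℂ) (∫ u : ℝ, Φ (u + θ * Complex.I)) := by
  rw [← integral_conj]
  congr 1
  ext u
  rw [← hc]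
  simp

lemma ml_sub_conj (z : ℂ) : z - (starRingEnd ℂ) z = ((2 * z.im : ℝ) : ℂ) * Complex.I := by
  apply Complex.ext <;> simp; ring

lemma ml_integrableOn (κ c x : ℝ) (hκ : 0 < κ) :
    IntegrableOn (fun u : ℝ => Real.exp (-κ * Real.exp u + c * u)) (Ioi x) := by
  rcases lt_or_ge 0 c with hc | hc
  · exact (ml_integrable_exp κ c hκ hc).integrableOn
  · have h := ((ml_integrable_exp κ 1 hκ one_pos).integrableOn (s := Ioi x)).const_mul
      (Real.exp ((c - 1) * x))
    refine Integrable.mono' h (by fun_prop) ?_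
    filter_upwards [ae_restrict_mem measurableSet_Ioi] with u hu
    rw [Real.norm_eq_abs, Real.abs_exp, ← Real.exp_add]
    apply Real.exp_le_exp.2
    have : x < u := hu
    nlinarith

lemma ml_gamma_im (θ c : ℝ) (h1 : Real.pi / 2 < θ) (h2 : θ < Real.pi) (hc : 0 < c) :
    (∫ u : ℝ, Complex.exp (Complex.exp (u + θ * Complex.I) + c * (u + θ * Complex.I))).im =
      Real.pi / Real.Gamma (1 - c) := by
  have hp := Real.pi_pos
  rw [ml_gamma_line θ c h1 h2 hc]
  have e : (Complex.exp (c * Real.pi * Complex.I) * Real.Gamma c).im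
      = Real.sin (c * Real.pi) * Real.Gamma c := by
    rw [Complex.im_mul_ofReal, ← Complex.ofReal_mul, Complex.exp_ofReal_mul_I_im]
  rw [e]
  have hr := Real.Gamma_mul_Gamma_one_sub c
  have hg := (Real.Gamma_pos_of_pos hc).ne'
  rw [mul_comm Real.pi c] at hr
  by_cases hs : Real.sin (c * Real.pi) = 0
  · rw [hs, div_zero] at hr
    have : Real.Gamma (1 - c) = 0 := by
      rcases mul_eq_zero.1 hr with h | h
      · exact absurd h hg
      · exact h
    rw [this, hs]; simp
  · have hne : Real.Gamma (1 - c) ≠ 0 := by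
      intro h
      rw [h, mul_zero] at hr
      exact (div_ne_zero hp.ne' hs) hr.symm
    field_simp at hr ⊢
    linarith

lemma ml_gamma_base (θ x c : ℝ) (h1 : Real.pi / 2 < θ) (h2 : θ < Real.pi) (hc : 0 < c) :
    mlH θ x (fun w => Complex.exp (Complex.exp w + c * w)) =
      ((2 * Real.pi / Real.Gamma (1 - c) : ℝ) : ℂ) * Complex.I := by
  have hκ : 0 < -Real.cos θ := by
    have := Real.cos_neg_of_pi_div_two_lt_of_lt h1 (by linarith)
    linarith
  have hp := Real.pi_pos
  have hi : Integrable (fun u : ℝ =>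
      Complex.exp (Complex.exp (u + θ * Complex.I) + c * (u + θ * Complex.I))) := by
    refine (integrable_norm_iff (by fun_prop)).1 ?_
    simp_rw [ml_norm]
    simpa using ml_integrable_exp _ _ hκ hc
  have hi' : Integrable (fun u : ℝ =>
      Complex.exp (Complex.exp (u + (-θ : ℝ) * Complex.I) + c * (u + (-θ : ℝ) * Complex.I))) := by
    refine (integrable_norm_iff (by fun_prop)).1 ?_
    simp_rw [ml_norm, Real.cos_neg]
    simpa using ml_integrable_exp _ _ hκ hc
  rw [mlH_collapse θ x (by linarith) (fun w => Complex.exp (Complex.exp w + c * w))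
    (by fun_prop) hi' hi (fun u => Real.exp (1 * Real.exp u + c * u))
    (by
      intro u v _
      rw [ml_norm]
      have := Real.cos_le_one v
      gcongr) (ml_tendsto_bot _ _ hc)]
  rw [ml_conj_line (fun w => Complex.exp (Complex.exp w + c * w)) θ (by
    intro w
    simp [← Complex.exp_conj]), ml_sub_conj]
  rw [ml_gamma_im θ c h1 h2 hc]
  congr 2
  ring

lemma ml_int_line (θ x c : ℝ) (hκ : 0 < -Real.cos θ) :
    IntegrableOn (fun u : ℝ =>
      Complex.exp (Complex.exp (u + θ * Complex.I) + c * (u + θ * Complex.I))) (Ioi x) := by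
  refine (integrable_norm_iff (by fun_prop)).1 ?_
  simp_rw [ml_norm]
  simpa [IntegrableOn] using ml_integrableOn (-Real.cos θ) c x hκ

lemma ml_hasDerivAt_line (θ c u : ℝ) :
    HasDerivAt (fun u : ℝ => Complex.exp (Complex.exp (u + θ * Complex.I) + c * (u + θ * Complex.I)))
      (Complex.exp (Complex.exp (u + θ * Complex.I) + (c + 1 : ℝ) * (u + θ * Complex.I)) +
        c * Complex.exp (Complex.exp (u + θ * Complex.I) + c * (u + θ * Complex.I))) u := by
  have h0 : HasDerivAt (fun u : ℝ => ((u : ℂ) + θ * Complex.I)) 1 u :=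
    (Complex.ofRealCLM.hasDerivAt (x := u)).add_const _
  have := (h0.cexp.add (h0.const_mul (c : ℂ))).cexp
  refine this.congr_deriv ?_
  push_cast
  rw [show Complex.exp (u + θ * Complex.I) + ((c : ℂ) + 1) * (u + θ * Complex.I) =
    (Complex.exp (u + θ * Complex.I) + c * (u + θ * Complex.I)) + (u + θ * Complex.I) by ring,
    Complex.exp_add (Complex.exp (u + θ * Complex.I) + c * (u + θ * Complex.I))]
  simp only [Pi.add_apply]
  ring

lemma ml_hasDerivAt_arc (x c v : ℝ) :
    HasDerivAt (fun v : ℝ => Complex.exp (Complex.exp (x + v * Complex.I) + c * (x + v * Complex.I)))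
      (Complex.I * (Complex.exp (Complex.exp (x + v * Complex.I) + (c + 1 : ℝ) * (x + v * Complex.I)) +
        c * Complex.exp (Complex.exp (x + v * Complex.I) + c * (x + v * Complex.I)))) v := by
  have h0 : HasDerivAt (fun v : ℝ => ((x : ℂ) + v * Complex.I)) (1 * Complex.I) v :=
    ((Complex.ofRealCLM.hasDerivAt (x := v)).mul_const _).const_add _
  have := (h0.cexp.add (h0.const_mul (c : ℂ))).cexp
  refine this.congr_deriv ?_
  push_cast
  rw [show Complex.exp (x + v * Complex.I) + ((c : ℂ) + 1) * (x + v * Complex.I) =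
    (Complex.exp (x + v * Complex.I) + c * (x + v * Complex.I)) + (x + v * Complex.I) by ring,
    Complex.exp_add (Complex.exp (x + v * Complex.I) + c * (x + v * Complex.I))]
  simp only [Pi.add_apply]
  ring

lemma mlH_rec (θ x c : ℝ) (hκ : 0 < -Real.cos θ) :
    mlH θ x (fun w => Complex.exp (Complex.exp w + (c + 1 : ℝ) * w)) +
      c * mlH θ x (fun w => Complex.exp (Complex.exp w + c * w)) = 0 := by
  have line : ∀ θ : ℝ, 0 < -Real.cos θ →
      (∫ u : ℝ in Ioi x, Complex.exp (Complex.exp (u + θ * Complex.I) + (c + 1 : ℝ) * (u + θ * Complex.I)))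
      + c * (∫ u : ℝ in Ioi x, Complex.exp (Complex.exp (u + θ * Complex.I) + c * (u + θ * Complex.I)))
      = - Complex.exp (Complex.exp (x + θ * Complex.I) + c * (x + θ * Complex.I)) := by
    intro θ hκ
    rw [← integral_const_mul, ← integral_add (ml_int_line θ x (c + 1) hκ)
      ((ml_int_line θ x c hκ).const_mul _)]
    rw [integral_Ioi_of_hasDerivAt_of_tendsto' (fun u _ => ml_hasDerivAt_line θ c u)
      ((ml_int_line θ x (c + 1) hκ).add ((ml_int_line θ x c hκ).const_mul _)) (m := 0)
      (by
        rw [tendsto_zero_iff_norm_tendsto_zero]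
        simp_rw [ml_norm]
        simpa using ml_tendsto_top (-Real.cos θ) c hκ)]
    simp
  have l1 := line θ hκ
  have l2 := line (-θ) (by rwa [Real.cos_neg])
  have l3 := intervalIntegral.integral_eq_sub_of_hasDerivAt (a := -θ) (b := θ)
    (fun v _ => ml_hasDerivAt_arc x c v) (Continuous.intervalIntegrable (by fun_prop) _ _)
  rw [intervalIntegral.integral_const_mul, intervalIntegral.integral_add
    (Continuous.intervalIntegrable (by fun_prop) _ _)
    (Continuous.intervalIntegrable (by fun_prop) _ _), intervalIntegral.integral_const_mul] at l3
  simp only [mlH]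
  linear_combination l1 - l2 + l3

lemma mlH_continuousAt_zero (θ x : ℝ) (hκ : 0 < -Real.cos θ) :
    ContinuousAt (fun c : ℝ => mlH θ x (fun w => Complex.exp (Complex.exp w + c * w))) 0 := by
  have line : ∀ θ : ℝ, 0 < -Real.cos θ → ContinuousAt (fun c : ℝ =>
      (∫ u : ℝ in Ioi x, Complex.exp (Complex.exp (u + θ * Complex.I) + c * (u + θ * Complex.I)))) 0 := by
    intro θ hκ
    refine continuousAt_of_dominated (bound := fun u => Real.exp (Real.cos θ * Real.exp u + 1 * u) +
      Real.exp (Real.cos θ * Real.exp u + (-1) * u)) (Eventually.of_forall fun c => by fun_prop) ?_ ?_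
      (Eventually.of_forall fun u => by fun_prop)
    · filter_upwards [Icc_mem_nhds (show (-1 : ℝ) < 0 by norm_num) (show (0 : ℝ) < 1 by norm_num)] with c hc
      refine Eventually.of_forall fun u => ?_
      rw [ml_norm]
      rcases le_total 0 u with hu | hu
      · have : Real.exp (Real.cos θ * Real.exp u + c * u) ≤ Real.exp (Real.cos θ * Real.exp u + 1 * u) := by
          apply Real.exp_le_exp.2
          nlinarith [hc.2]
        linarith [Real.exp_pos (Real.cos θ * Real.exp u + (-1) * u)]
      · have : Real.exp (Real.cos θ * Real.exp u + c * u) ≤ Real.exp (Real.cos θ * Real.exp u + (-1) * u) := by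
          apply Real.exp_le_exp.2
          nlinarith [hc.1]
        linarith [Real.exp_pos (Real.cos θ * Real.exp u + 1 * u)]
    · have a := ml_integrableOn (-Real.cos θ) 1 x hκ
      have b := ml_integrableOn (-Real.cos θ) (-1) x hκ
      simp only [neg_neg] at a b
      exact a.add b
  have arc : Continuous (fun c : ℝ => ∫ v : ℝ in (-θ)..θ,
      Complex.exp (Complex.exp (x + v * Complex.I) + c * (x + v * Complex.I))) := by
    apply intervalIntegral.continuous_parametric_intervalIntegral_of_continuous'
    fun_prop
  exact ((line θ hκ).sub (line (-θ) (by rwa [Real.cos_neg]))).add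
    (continuousAt_const.mul arc.continuousAt)

/-- The Hankel formula in logarithmic coordinates. -/
lemma mlH_gamma (θ x : ℝ) (h1 : Real.pi / 2 < θ) (h2 : θ < Real.pi) (c : ℝ) :
    mlH θ x (fun w => Complex.exp (Complex.exp w + c * w)) =
      ((2 * Real.pi / Real.Gamma (1 - c) : ℝ) : ℂ) * Complex.I := by
  have hκ : 0 < -Real.cos θ := by
    have := Real.cos_neg_of_pi_div_two_lt_of_lt h1 (by linarith)
    linarith
  have main : ∀ n : ℕ, ∀ c : ℝ, -(n : ℝ) < c →
      mlH θ x (fun w => Complex.exp (Complex.exp w + c * w)) =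
      ((2 * Real.pi / Real.Gamma (1 - c) : ℝ) : ℂ) * Complex.I := by
    intro n
    induction n with
    | zero => intro c hc; exact ml_gamma_base θ x c h1 h2 (by simpa using hc)
    | succ n ih =>
      intro c hc
      rcases lt_trichotomy c 0 with h | h | h
      · have e1 := ih (c + 1) (by push_cast at hc; linarith)
        have e2 := mlH_rec θ x c hκ
        rw [e1] at e2
        have hg : Real.Gamma (1 - c) = (-c) * Real.Gamma (1 - (c + 1)) := by
          rw [show 1 - c = -c + 1 by ring, Real.Gamma_add_one (by linarith)]
          ring_nf
        have hg0 : Real.Gamma (1 - (c + 1)) ≠ 0 := (Real.Gamma_pos_of_pos (by linarith)).ne'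
        have hc0 : (c : ℂ) ≠ 0 := by exact_mod_cast h.ne
        apply mul_left_cancel₀ hc0
        have e3 : ((2 * Real.pi / Real.Gamma (1 - (c + 1)) : ℝ) : ℂ) = -(c * ((2 * Real.pi / Real.Gamma (1 - c) : ℝ) : ℂ)) := by
          rw [hg]
          have := h.ne
          norm_cast
          field_simp
        rw [e3] at e2
        linear_combination e2
      · subst h
        have t1 : Tendsto (fun c : ℝ => mlH θ x (fun w => Complex.exp (Complex.exp w + c * w)))
          (𝓝[>] 0) _ := (mlH_continuousAt_zero θ x hκ).tendsto.mono_left nhdsWithin_le_nhds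
        have t2 : ContinuousAt (fun c : ℝ => ((2 * Real.pi / Real.Gamma (1 - c) : ℝ) : ℂ) * Complex.I) 0 := by
          have hG : ContinuousAt Real.Gamma (1 - 0) :=
            (Real.differentiableAt_Gamma (fun m => by have : (0:ℝ) ≤ m := m.cast_nonneg; linarith)).continuousAt
          have hG' : ContinuousAt (fun c : ℝ => Real.Gamma (1 - c)) 0 :=
            ContinuousAt.comp (f := fun c : ℝ => 1 - c) hG (by fun_prop)
          have : ContinuousAt (fun c : ℝ => 2 * Real.pi / Real.Gamma (1 - c)) 0 :=
            continuousAt_const.div hG' (by simp)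
          exact (Complex.continuous_ofReal.continuousAt.comp this).mul continuousAt_const
        have t3 := (t2.tendsto.mono_left (nhdsWithin_le_nhds (s := Ioi 0)))
        refine tendsto_nhds_unique t1 (t3.congr' ?_)
        filter_upwards [self_mem_nhdsWithin] with c hc
        exact (ml_gamma_base θ x c h1 h2 hc).symm
      · exact ml_gamma_base θ x c h1 h2 h
  obtain ⟨n, hn⟩ := exists_nat_gt (-c)
  exact main n c (by linarith)

/-- Lower bounds for `|e^{ρw} + X|` in the strip. -/
lemma ml_lower (θ : ℝ) (h1 : Real.pi / 2 < θ) (h2 : θ < Real.pi) (ρ X u v : ℝ) (hρ0 : 0 < ρ)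
    (hρ1 : ρ ≤ 1) (hX : 0 < X) (hv : |v| ≤ θ) :
    Real.sin θ * X ≤ ‖Complex.exp (ρ * (u + v * Complex.I)) + X‖ ∧
    Real.sin θ * Real.exp (ρ * u) ≤ ‖Complex.exp (ρ * (u + v * Complex.I)) + X‖ := by
  set R := Real.exp (ρ * u) with hR
  have hRp : 0 < R := Real.exp_pos _
  have hcos : Real.cos θ ≤ Real.cos (ρ * v) := by
    rw [← Real.cos_abs (ρ * v)]
    apply Real.cos_le_cos_of_nonneg_of_le_pi (abs_nonneg _) h2.le
    rw [abs_mul, abs_of_pos hρ0]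
    nlinarith [abs_nonneg v]
  have hsin : 0 < Real.sin θ := Real.sin_pos_of_pos_of_lt_pi (by linarith [Real.pi_pos]) h2
  have hn : ‖Complex.exp (ρ * (u + v * Complex.I)) + X‖ ^ 2 =
      R ^ 2 + X ^ 2 + 2 * R * X * Real.cos (ρ * v) := by
    rw [← Complex.normSq_eq_norm_sq, Complex.normSq_apply]
    have e : (ρ * (u + v * Complex.I) : ℂ) = (ρ * u : ℝ) + (ρ * v : ℝ) * Complex.I := by
      push_cast; ring
    rw [e]
    simp only [Complex.add_re, Complex.add_im, Complex.exp_re, Complex.exp_im, Complex.ofReal_re,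
      Complex.ofReal_im, Complex.re_ofReal_mul, Complex.im_ofReal_mul, Complex.I_re, Complex.I_im,
      mul_zero, mul_one, add_zero, zero_add, ← hR]
    nlinarith [Real.sin_sq_add_cos_sq (ρ * v)]
  have hp : 0 < 2 * R * X := by positivity
  have hsc := Real.sin_sq_add_cos_sq θ
  constructor
  · apply le_of_sq_le_sq _ (norm_nonneg _)
    rw [hn]
    nlinarith [sq_nonneg (R + X * Real.cos θ), mul_le_mul_of_nonneg_left hcos hp.le]
  · apply le_of_sq_le_sq _ (norm_nonneg _)
    rw [hn]
    nlinarith [sq_nonneg (X + R * Real.cos θ), mul_le_mul_of_nonneg_left hcos hp.le]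

/-- The integrand of the contour representation. -/
noncomputable def mlF (ρ X : ℝ) (w : ℂ) : ℂ :=
  Complex.exp (Complex.exp w + w) / (Complex.exp (ρ * w) + X)

lemma mlF_ne (θ : ℝ) (h1 : Real.pi / 2 < θ) (h2 : θ < Real.pi) (ρ X : ℝ) (hρ0 : 0 < ρ)
    (hρ1 : ρ ≤ 1) (hX : 0 < X) (w : ℂ) (hw : |w.im| ≤ θ) : Complex.exp (ρ * w) + X ≠ 0 := by
  have h := (ml_lower θ h1 h2 ρ X w.re w.im hρ0 hρ1 hX hw).1
  rw [Complex.re_add_im] at h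
  have hsin : 0 < Real.sin θ := Real.sin_pos_of_pos_of_lt_pi (by linarith [Real.pi_pos]) h2
  intro h0
  rw [h0, norm_zero] at h
  nlinarith [mul_pos hsin hX]

lemma mlF_norm (θ : ℝ) (h1 : Real.pi / 2 < θ) (h2 : θ < Real.pi) (ρ X u v : ℝ) (hρ0 : 0 < ρ)
    (hρ1 : ρ ≤ 1) (hX : 0 < X) (hv : |v| ≤ θ) :
    ‖mlF ρ X (u + v * Complex.I)‖ ≤
      (Real.sin θ * X)⁻¹ * Real.exp (Real.cos v * Real.exp u + 1 * u) := by
  have h := (ml_lower θ h1 h2 ρ X u v hρ0 hρ1 hX hv).1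
  have hsin : 0 < Real.sin θ := Real.sin_pos_of_pos_of_lt_pi (by linarith [Real.pi_pos]) h2
  have e := ml_norm 1 u v
  simp only [Complex.ofReal_one, one_mul] at e
  rw [mlF, norm_div, e, one_mul, mul_comm (Real.sin θ * X)⁻¹, ← div_eq_mul_inv]
  have := mul_pos hsin hX
  gcongr

lemma mlF_collapse (θ x : ℝ) (h1 : Real.pi / 2 < θ) (h2 : θ < Real.pi) (ρ X : ℝ) (hρ0 : 0 < ρ)
    (hρ1 : ρ ≤ 1) (hX : 0 < X) :
    mlH θ x (mlF ρ X) = ((2 * (∫ u : ℝ, mlF ρ X (u + θ * Complex.I)).im : ℝ) : ℂ) * Complex.I := by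
  have hκ : 0 < -Real.cos θ := by
    have := Real.cos_neg_of_pi_div_two_lt_of_lt h1 (by linarith)
    linarith
  have hp := Real.pi_pos
  have hsin : 0 < Real.sin θ := Real.sin_pos_of_pos_of_lt_pi (by linarith [Real.pi_pos]) h2
  have hint : ∀ v : ℝ, |v| ≤ θ → 0 < -Real.cos v →
      Integrable (fun u : ℝ => mlF ρ X (u + v * Complex.I)) := by
    intro v hv hκ
    have hb := (ml_integrable_exp (-Real.cos v) 1 hκ one_pos).const_mul ((Real.sin θ * X)⁻¹)
    simp only [neg_neg] at hb
    refine Integrable.mono' hb ?_ (Eventually.of_forall fun u =>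
      mlF_norm θ h1 h2 ρ X u v hρ0 hρ1 hX hv)
    apply Continuous.aestronglyMeasurable
    unfold mlF
    refine Continuous.div (by fun_prop) (by fun_prop) fun u => ?_
    apply mlF_ne θ h1 h2 ρ X hρ0 hρ1 hX
    simpa using hv
  have hθ : |θ| ≤ θ := by rw [abs_of_pos (by linarith)]
  rw [mlH_collapse θ x (by linarith) (mlF ρ X) (by
      unfold mlF
      refine DifferentiableOn.div (by fun_prop) (by fun_prop) fun w hw => ?_
      exact mlF_ne θ h1 h2 ρ X hρ0 hρ1 hX w hw)
    (hint (-θ) (by rwa [abs_neg]) (by rwa [Real.cos_neg])) (hint θ hθ hκ)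
    (fun u => (Real.sin θ * X)⁻¹ * Real.exp (1 * Real.exp u + 1 * u))
    (by
      intro u v hv
      refine (mlF_norm θ h1 h2 ρ X u v hρ0 hρ1 hX hv).trans ?_
      have := Real.cos_le_one v
      have := mul_pos hsin hX
      gcongr)
    (by simpa using (ml_tendsto_bot 1 1 one_pos).const_mul ((Real.sin θ * X)⁻¹))]
  rw [ml_conj_line (mlF ρ X) θ (by
    intro w
    simp [mlF, ← Complex.exp_conj]), ml_sub_conj]

lemma mlF_hasSum_pt (ρ X x u v : ℝ) (hρ0 : 0 < ρ) (hX : 0 < X) (hx : X < Real.exp (ρ * x))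
    (hu : x ≤ u) :
    HasSum (fun k : ℕ => ((-X) ^ k : ℂ) * Complex.exp (Complex.exp (u + v * Complex.I) +
      (1 - (ρ * k + ρ) : ℝ) * (u + v * Complex.I))) (mlF ρ X (u + v * Complex.I)) := by
  set w : ℂ := u + v * Complex.I with hw
  have hr : ‖(-X : ℂ) * Complex.exp (-(ρ * w))‖ < 1 := by
    rw [norm_mul, norm_neg, Complex.norm_real, Real.norm_eq_abs, abs_of_pos hX, Complex.norm_exp]
    have : (-(ρ * w)).re = -(ρ * u) := by simp [hw]
    rw [this, Real.exp_neg, ← div_eq_mul_inv, div_lt_one (Real.exp_pos _)]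
    refine hx.trans_le (Real.exp_le_exp.2 (by gcongr))
  have h := (hasSum_geometric_of_norm_lt_one hr).mul_left
    (Complex.exp (Complex.exp w + w) * Complex.exp (-(ρ * w)))
  have hne : (1 - (-X : ℂ) * Complex.exp (-(ρ * w))) ≠ 0 := by
    intro h0
    rw [← sub_eq_zero.1 h0] at hr
    simp at hr
  have e : Complex.exp (ρ * w) + X =
      Complex.exp (ρ * w) * (1 - (-X : ℂ) * Complex.exp (-(ρ * w))) := by
    rw [Complex.exp_neg]
    have := Complex.exp_ne_zero (ρ * w)
    field_simp
    ring
  have e2 : mlF ρ X w = Complex.exp (Complex.exp w + w) * Complex.exp (-(ρ * w)) *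
      (1 - (-X : ℂ) * Complex.exp (-(ρ * w)))⁻¹ := by
    unfold mlF
    rw [e, Complex.exp_neg (ρ * w), div_eq_mul_inv, mul_inv]
    ring
  rw [e2]
  refine h.congr_fun fun k => ?_
  rw [mul_pow, ← Complex.exp_nat_mul, mul_left_comm, ← Complex.exp_add, ← Complex.exp_add]
  congr 2
  push_cast
  ring

lemma mlF_term_norm (ρ X x u v : ℝ) (hρ0 : 0 < ρ) (hX : 0 < X) (hu : x ≤ u) (k : ℕ) :
    ‖((-X) ^ k : ℂ) * Complex.exp (Complex.exp (u + v * Complex.I) +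
      (1 - (ρ * k + ρ) : ℝ) * (u + v * Complex.I))‖ ≤
      Real.exp (Real.cos v * Real.exp u + (1 - ρ) * u) * (X * Real.exp (-(ρ * x))) ^ k := by
  rw [norm_mul, ml_norm, norm_pow, norm_neg, Complex.norm_real, Real.norm_eq_abs, abs_of_pos hX,
    mul_pow, ← Real.exp_nat_mul, mul_left_comm, ← Real.exp_add]
  gcongr ?_ * Real.exp ?_
  have hk : (0 : ℝ) ≤ k := k.cast_nonneg
  nlinarith [mul_le_mul_of_nonneg_left hu (mul_nonneg hk hρ0.le)]

lemma mlF_hasSum (θ x : ℝ) (hκ : 0 < -Real.cos θ) (ρ X : ℝ)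
    (hρ0 : 0 < ρ) (hX : 0 < X) (hx : X < Real.exp (ρ * x)) :
    HasSum (fun k : ℕ => ((-X) ^ k : ℂ) *
      mlH θ x (fun w => Complex.exp (Complex.exp w + (1 - (ρ * k + ρ) : ℝ) * w)))
      (mlH θ x (mlF ρ X)) := by
  set q := X * Real.exp (-(ρ * x)) with hq
  have hq0 : 0 ≤ q := by positivity
  have hq1 : q < 1 := by
    rw [hq, Real.exp_neg, ← div_eq_mul_inv, div_lt_one (Real.exp_pos _)]; exact hx
  have hgeo := hasSum_geometric_of_lt_one hq0 hq1
  have line : ∀ θ : ℝ, 0 < -Real.cos θ → HasSum (fun k : ℕ => ∫ u : ℝ in Ioi x, ((-X) ^ k : ℂ) *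
      Complex.exp (Complex.exp (u + θ * Complex.I) + (1 - (ρ * k + ρ) : ℝ) * (u + θ * Complex.I)))
      (∫ u : ℝ in Ioi x, mlF ρ X (u + θ * Complex.I)) := by
    intro θ hκ
    refine hasSum_integral_of_dominated_convergence
      (fun k u => Real.exp (Real.cos θ * Real.exp u + (1 - ρ) * u) * q ^ k)
      (fun k => by fun_prop) (fun k => ?_) ?_ ?_ ?_
    · filter_upwards [ae_restrict_mem measurableSet_Ioi] with u hu
      exact mlF_term_norm ρ X x u θ hρ0 hX (le_of_lt hu) k
    · exact Eventually.of_forall fun u => hgeo.summable.mul_left _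
    · simp_rw [tsum_mul_left]
      have := ml_integrableOn (-Real.cos θ) (1 - ρ) x hκ
      simp only [neg_neg] at this
      exact Integrable.mul_const this _
    · filter_upwards [ae_restrict_mem measurableSet_Ioi] with u hu
      exact mlF_hasSum_pt ρ X x u θ hρ0 hX hx (le_of_lt hu)
  have arc : HasSum (fun k : ℕ => ∫ v : ℝ in (-θ)..θ, ((-X) ^ k : ℂ) *
      Complex.exp (Complex.exp (x + v * Complex.I) + (1 - (ρ * k + ρ) : ℝ) * (x + v * Complex.I)))
      (∫ v : ℝ in (-θ)..θ, mlF ρ X (x + v * Complex.I)) := by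
    refine intervalIntegral.hasSum_integral_of_dominated_convergence
      (fun k v => Real.exp (Real.cos v * Real.exp x + (1 - ρ) * x) * q ^ k)
      (fun k => by fun_prop) (fun k => ?_) ?_ ?_ ?_
    · exact Eventually.of_forall fun v _ => mlF_term_norm ρ X x x v hρ0 hX le_rfl k
    · exact Eventually.of_forall fun v _ => hgeo.summable.mul_left _
    · simp_rw [tsum_mul_left]
      exact Continuous.intervalIntegrable (by fun_prop) _ _
    · exact Eventually.of_forall fun v _ => mlF_hasSum_pt ρ X x x v hρ0 hX hx le_rfl
  have h := ((line θ hκ).sub (line (-θ) (by rwa [Real.cos_neg]))).add (arc.mul_left Complex.I)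
  simp only [integral_const_mul, intervalIntegral.integral_const_mul] at h
  exact h.congr_fun fun k => by simp only [mlH]; ring


lemma ml_rep (θ : ℝ) (h1 : Real.pi / 2 < θ) (h2 : θ < Real.pi) (ρ X : ℝ) (hρ0 : 0 < ρ)
    (hρ1 : ρ ≤ 1) (hX : 0 < X) :
    mittagLeffler ρ ρ (-X) = (∫ u : ℝ, mlF ρ X (u + θ * Complex.I)).im / Real.pi := by
  have hκ : 0 < -Real.cos θ := by
    have := Real.cos_neg_of_pi_div_two_lt_of_lt h1 (by linarith)
    linarith
  have hp := Real.pi_pos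
  obtain ⟨x, hx⟩ : ∃ x : ℝ, X < Real.exp (ρ * x) := by
    refine ⟨X / ρ, ?_⟩
    rw [mul_div_cancel₀ _ hρ0.ne']
    linarith [Real.add_one_le_exp X]
  have h := mlF_hasSum θ x hκ ρ X hρ0 hX hx
  simp_rw [mlH_gamma θ x h1 h2, mlF_collapse θ x h1 h2 ρ X hρ0 hρ1 hX] at h
  have h3 := Complex.hasSum_im h
  have h4 : HasSum (fun k : ℕ => (-X) ^ k / Real.Gamma (ρ * k + ρ))
      ((∫ u : ℝ, mlF ρ X (u + θ * Complex.I)).im / Real.pi) := by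
    have h5 := h3.mul_left (1 / (2 * Real.pi))
    have e : 1 / (2 * Real.pi) * (((2 * (∫ u : ℝ, mlF ρ X (u + θ * Complex.I)).im : ℝ) : ℂ) * Complex.I).im
      = (∫ u : ℝ, mlF ρ X (u + θ * Complex.I)).im / Real.pi := by
      rw [Complex.im_ofReal_mul, Complex.I_im]
      field_simp
    rw [e] at h5
    refine h5.congr_fun fun k => ?_
    rw [show ((-X : ℂ) ^ k) = (((-X) ^ k : ℝ) : ℂ) by push_cast; ring, Complex.im_ofReal_mul,
      Complex.im_ofReal_mul, Complex.I_im]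
    rw [show 1 - (1 - (ρ * k + ρ)) = ρ * k + ρ by ring]
    field_simp
  rw [mittagLeffler]
  exact h4.tsum_eq

/-- The integrand of the remainder. -/
noncomputable def mlG (ρ X : ℝ) (w : ℂ) : ℂ :=
  Complex.exp (Complex.exp w + (1 + 2 * ρ : ℝ) * w) / (Complex.exp (ρ * w) + X)

lemma mlG_norm (θ : ℝ) (h1 : Real.pi / 2 < θ) (h2 : θ < Real.pi) (ρ X u v : ℝ) (hρ0 : 0 < ρ)
    (hρ1 : ρ ≤ 1) (hX : 0 < X) (hv : |v| ≤ θ) :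
    ‖mlG ρ X (u + v * Complex.I)‖ ≤
      (Real.sin θ * X)⁻¹ * Real.exp (Real.cos v * Real.exp u + (1 + 2 * ρ) * u) := by
  have h := (ml_lower θ h1 h2 ρ X u v hρ0 hρ1 hX hv).1
  have hsin : 0 < Real.sin θ := Real.sin_pos_of_pos_of_lt_pi (by linarith [Real.pi_pos]) h2
  rw [mlG, norm_div, ml_norm, mul_comm (Real.sin θ * X)⁻¹, ← div_eq_mul_inv]
  have := mul_pos hsin hX
  gcongr

lemma mlG_continuous (θ : ℝ) (h1 : Real.pi / 2 < θ) (h2 : θ < Real.pi) (ρ X : ℝ) (hρ0 : 0 < ρ)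
    (hρ1 : ρ ≤ 1) (hX : 0 < X) : Continuous (fun u : ℝ => mlG ρ X (u + θ * Complex.I)) := by
  unfold mlG
  refine Continuous.div (by fun_prop) (by fun_prop) fun u => ?_
  apply mlF_ne θ h1 h2 ρ X hρ0 hρ1 hX
  simp [abs_of_pos (show 0 < θ by linarith [Real.pi_pos])]

lemma mlG_integrable (θ : ℝ) (h1 : Real.pi / 2 < θ) (h2 : θ < Real.pi) (ρ X : ℝ) (hρ0 : 0 < ρ)
    (hρ1 : ρ ≤ 1) (hX : 0 < X) : Integrable (fun u : ℝ => mlG ρ X (u + θ * Complex.I)) := by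
  have hκ : 0 < -Real.cos θ := by
    have := Real.cos_neg_of_pi_div_two_lt_of_lt h1 (by linarith)
    linarith
  have hb := (ml_integrable_exp (-Real.cos θ) (1 + 2 * ρ) hκ (by linarith)).const_mul
    ((Real.sin θ * X)⁻¹)
  simp only [neg_neg] at hb
  refine Integrable.mono' hb (mlG_continuous θ h1 h2 ρ X hρ0 hρ1 hX).aestronglyMeasurable
    (Eventually.of_forall fun u => mlG_norm θ h1 h2 ρ X u θ hρ0 hρ1 hX ?_)
  rw [abs_of_pos (by linarith [Real.pi_pos])]

lemma ml_rep2 (θ : ℝ) (h1 : Real.pi / 2 < θ) (h2 : θ < Real.pi) (ρ X : ℝ) (hρ0 : 0 < ρ)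
    (hρ1 : ρ ≤ 1) (hX : 0 < X) :
    mittagLeffler ρ ρ (-X) = X⁻¹ ^ 2 * (-1 / Real.Gamma (-ρ) +
      (∫ u : ℝ, mlG ρ X (u + θ * Complex.I)).im / Real.pi) := by
  have hκ : 0 < -Real.cos θ := by
    have := Real.cos_neg_of_pi_div_two_lt_of_lt h1 (by linarith)
    linarith
  have hp := Real.pi_pos
  have hi : ∀ c : ℝ, 0 < c → Integrable (fun u : ℝ =>
      Complex.exp (Complex.exp (u + θ * Complex.I) + c * (u + θ * Complex.I))) := by
    intro c hc
    refine (integrable_norm_iff (by fun_prop)).1 ?_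
    simp_rw [ml_norm]
    simpa using ml_integrable_exp _ _ hκ hc
  have hXc : (X : ℂ) ≠ 0 := by exact_mod_cast hX.ne'
  have e : ∀ u : ℝ, mlF ρ X (u + θ * Complex.I) =
      (X : ℂ)⁻¹ * Complex.exp (Complex.exp (u + θ * Complex.I) + (1 : ℝ) * (u + θ * Complex.I))
      - (X : ℂ)⁻¹ ^ 2 * Complex.exp (Complex.exp (u + θ * Complex.I) + (1 + ρ : ℝ) * (u + θ * Complex.I))
      + (X : ℂ)⁻¹ ^ 2 * mlG ρ X (u + θ * Complex.I) := by
    intro u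
    have hne := mlF_ne θ h1 h2 ρ X hρ0 hρ1 hX (u + θ * Complex.I)
      (by simp [abs_of_pos (show 0 < θ by linarith)])
    unfold mlF mlG
    set w : ℂ := u + θ * Complex.I
    have a1 : Complex.exp (Complex.exp w + (1 : ℝ) * w) = Complex.exp (Complex.exp w + w) := by simp
    have a2 : Complex.exp (Complex.exp w + (1 + ρ : ℝ) * w) =
      Complex.exp (Complex.exp w + w) * Complex.exp (ρ * w) := by
      rw [← Complex.exp_add]; congr 1; push_cast; ring
    have a3 : Complex.exp (Complex.exp w + (1 + 2 * ρ : ℝ) * w) =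
      Complex.exp (Complex.exp w + w) * Complex.exp (ρ * w) ^ 2 := by
      rw [← Complex.exp_nat_mul, ← Complex.exp_add]; congr 1; push_cast; ring
    rw [a1, a2, a3]
    generalize Complex.exp (ρ * w) = E at hne ⊢
    generalize Complex.exp (Complex.exp w + w) = A
    field_simp
    ring
  rw [ml_rep θ h1 h2 ρ X hρ0 hρ1 hX]
  simp_rw [e]
  have i1 := (hi 1 one_pos).const_mul ((X : ℂ)⁻¹)
  have i2 := (hi (1 + ρ) (by linarith)).const_mul ((X : ℂ)⁻¹ ^ 2)
  have i3 := (mlG_integrable θ h1 h2 ρ X hρ0 hρ1 hX).const_mul ((X : ℂ)⁻¹ ^ 2)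
  have i12 : Integrable (fun u : ℝ =>
      (X : ℂ)⁻¹ * Complex.exp (Complex.exp (u + θ * Complex.I) + (1 : ℝ) * (u + θ * Complex.I))
      - (X : ℂ)⁻¹ ^ 2 * Complex.exp (Complex.exp (u + θ * Complex.I) + (1 + ρ : ℝ) * (u + θ * Complex.I))) :=
    i1.sub i2
  rw [integral_add i12 i3, integral_sub i1 i2, integral_const_mul, integral_const_mul,
    integral_const_mul]
  have g1 := ml_gamma_im θ 1 h1 h2 one_pos
  have g2 := ml_gamma_im θ (1 + ρ) h1 h2 (by linarith)
  rw [Complex.add_im, Complex.sub_im, ← Complex.ofReal_inv, ← Complex.ofReal_pow,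
    Complex.im_ofReal_mul, Complex.im_ofReal_mul, Complex.im_ofReal_mul, g1, g2]
  rw [show (1 : ℝ) - 1 = 0 by ring, Real.Gamma_zero, show 1 - (1 + ρ) = -ρ by ring]
  field_simp
  simp [div_eq_mul_inv]

/-- The dominating function. -/
noncomputable def mlM (θ u : ℝ) : ℝ :=
  (Real.exp (Real.cos θ * Real.exp u + 1 * u) + Real.exp (Real.cos θ * Real.exp u + 3 * u)) *
    (|u| + Real.pi + 1)

lemma mlM_nonneg (θ u : ℝ) : 0 ≤ mlM θ u := by
  unfold mlM
  have := Real.pi_pos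
  positivity

lemma ml_exp_le_mlM (θ ρ u : ℝ) (hρ0 : 0 < ρ) (hρ1 : ρ ≤ 1) :
    Real.exp (Real.cos θ * Real.exp u + (1 + 2 * ρ) * u) ≤
    Real.exp (Real.cos θ * Real.exp u + 1 * u) + Real.exp (Real.cos θ * Real.exp u + 3 * u) := by
  rcases le_total 0 u with hu | hu
  · have : Real.exp (Real.cos θ * Real.exp u + (1 + 2 * ρ) * u) ≤
        Real.exp (Real.cos θ * Real.exp u + 3 * u) := by
      apply Real.exp_le_exp.2
      nlinarith
    linarith [Real.exp_pos (Real.cos θ * Real.exp u + 1 * u)]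
  · have : Real.exp (Real.cos θ * Real.exp u + (1 + 2 * ρ) * u) ≤
        Real.exp (Real.cos θ * Real.exp u + 1 * u) := by
      apply Real.exp_le_exp.2
      nlinarith
    linarith [Real.exp_pos (Real.cos θ * Real.exp u + 3 * u)]

lemma mlM_integrable (θ : ℝ) (hκ : 0 < -Real.cos θ) : Integrable (mlM θ) := by
  have i : ∀ c : ℝ, 0 < c → Integrable (fun u : ℝ => Real.exp (Real.cos θ * Real.exp u + c * u)) := by
    intro c hc
    simpa using ml_integrable_exp (-Real.cos θ) c hκ hc
  have key : ∀ c : ℝ, 1 ≤ c → Integrable (fun u : ℝ =>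
      Real.exp (Real.cos θ * Real.exp u + c * u) * (|u| + Real.pi + 1)) := by
    intro c hc
    have hb := (((i (c + 1 / 2) (by linarith)).const_mul 2).add
      ((i (c - 1 / 2) (by linarith)).const_mul 2)).add ((i c (by linarith)).const_mul (Real.pi + 1))
    refine Integrable.mono' hb (by fun_prop) (Eventually.of_forall fun u => ?_)
    have hp := Real.pi_pos
    rw [Real.norm_eq_abs, abs_of_nonneg (by positivity)]
    simp only [Pi.add_apply]
    rw [show Real.cos θ * Real.exp u + (c + 1 / 2) * u =
      (Real.cos θ * Real.exp u + c * u) + u / 2 by ring,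
      show Real.cos θ * Real.exp u + (c - 1 / 2) * u =
      (Real.cos θ * Real.exp u + c * u) + -u / 2 by ring, Real.exp_add _ (u / 2),
      Real.exp_add _ (-u / 2)]
    have hu : |u| ≤ 2 * Real.exp (u / 2) + 2 * Real.exp (-u / 2) := by
      have a1 := Real.add_one_le_exp (u / 2)
      have a2 := Real.add_one_le_exp (-u / 2)
      have p1 := Real.exp_pos (u / 2)
      have p2 := Real.exp_pos (-u / 2)
      apply abs_le.2
      constructor <;> linarith
    have hE := Real.exp_pos (Real.cos θ * Real.exp u + c * u)
    nlinarith [mul_le_mul_of_nonneg_left hu hE.le]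
  refine ((key 1 le_rfl).add (key 3 (by norm_num))).congr (Eventually.of_forall fun u => ?_)
  simp only [Pi.add_apply, mlM]
  ring

noncomputable def mlG' (ρ L X : ℝ) (w : ℂ) : ℂ :=
  mlG ρ X w * (2 * w - (w * Complex.exp (ρ * w) + L * X) / (Complex.exp (ρ * w) + X))

lemma mlG_hasDerivAt (θ : ℝ) (h1 : Real.pi / 2 < θ) (h2 : θ < Real.pi) (ρ lam L u : ℝ)
    (hρ0 : 0 < ρ) (hρ1 : ρ ≤ 1) (hlam : 0 < lam) :
    HasDerivAt (fun r : ℝ => mlG r (lam * Real.exp (L * r)) (u + θ * Complex.I))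
      (mlG' ρ L (lam * Real.exp (L * ρ)) (u + θ * Complex.I)) ρ := by
  have hX : 0 < lam * Real.exp (L * ρ) := by positivity
  have hne := mlF_ne θ h1 h2 ρ _ hρ0 hρ1 hX (u + θ * Complex.I)
      (by simp [abs_of_pos (show 0 < θ by linarith [Real.pi_pos])])
  unfold mlG' mlG
  set w : ℂ := u + θ * Complex.I
  have d0 : HasDerivAt (fun r : ℝ => (r : ℂ)) 1 ρ := Complex.ofRealCLM.hasDerivAt
  have d1 : HasDerivAt (fun r : ℝ => Complex.exp (Complex.exp w + (1 + 2 * r : ℝ) * w))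
      (Complex.exp (Complex.exp w + (1 + 2 * ρ : ℝ) * w) * (2 * w)) ρ := by
    have := ((((d0.const_mul 2).const_add 1).mul_const w).const_add (Complex.exp w)).cexp
    simpa using this
  have d2 : HasDerivAt (fun r : ℝ => Complex.exp (r * w)) (Complex.exp (ρ * w) * w) ρ := by
    simpa using (d0.mul_const w).cexp
  have d3 : HasDerivAt (fun r : ℝ => lam * Real.exp (L * r)) (lam * (Real.exp (L * ρ) * L)) ρ := by
    simpa using (((hasDerivAt_id ρ).const_mul L).exp).const_mul lam
  have d4 := d1.div (d2.add d3.ofReal_comp) hne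
  refine d4.congr_deriv ?_
  simp only [Pi.add_apply]
  rw [show ((lam * (Real.exp (L * ρ) * L) : ℝ) : ℂ) = L * ((lam * Real.exp (L * ρ) : ℝ) : ℂ) by
    push_cast; ring]
  generalize ((lam * Real.exp (L * ρ) : ℝ) : ℂ) = X at hne ⊢
  generalize Complex.exp (Complex.exp w + (1 + 2 * ρ : ℝ) * w) = A
  generalize Complex.exp (ρ * w) = E at hne ⊢
  field_simp

lemma mlG'_norm (θ : ℝ) (h1 : Real.pi / 2 < θ) (h2 : θ < Real.pi) (ρ L X u : ℝ)
    (hρ0 : 0 < ρ) (hρ1 : ρ ≤ 1) (hX : 0 < X) (hL : 0 ≤ L) :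
    ‖mlG' ρ L X (u + θ * Complex.I)‖ ≤ 3 / Real.sin θ ^ 2 * (1 + L) / X * mlM θ u := by
  have hp := Real.pi_pos
  have hθ : |θ| ≤ θ := by rw [abs_of_pos (by linarith)]
  have hs : 0 < Real.sin θ := Real.sin_pos_of_pos_of_lt_pi (by linarith) h2
  have hs1 := Real.sin_le_one θ
  have hl := ml_lower θ h1 h2 ρ X u θ hρ0 hρ1 hX hθ
  have hG := mlG_norm θ h1 h2 ρ X u θ hρ0 hρ1 hX hθ
  have hE := ml_exp_le_mlM θ ρ u hρ0 hρ1
  have hnE : ‖Complex.exp (ρ * (u + θ * Complex.I))‖ = Real.exp (ρ * u) := by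
    rw [Complex.norm_exp]; simp
  have hw : ‖(u + θ * Complex.I : ℂ)‖ ≤ |u| + Real.pi := by
    refine (norm_add_le _ _).trans ?_
    rw [norm_mul, Complex.norm_I, Complex.norm_real, Complex.norm_real, Real.norm_eq_abs,
      Real.norm_eq_abs, abs_of_pos (show 0 < θ by linarith)]
    linarith
  unfold mlG'
  set w : ℂ := u + θ * Complex.I
  set N := ‖Complex.exp (ρ * w) + X‖
  have hN : 0 < N := lt_of_lt_of_le (mul_pos hs hX) hl.1
  have hq : ‖(w * Complex.exp (ρ * w) + L * X) / (Complex.exp (ρ * w) + X)‖ ≤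
      (‖w‖ + L) / Real.sin θ := by
    rw [norm_div, div_le_div_iff₀ hN hs]
    have : ‖w * Complex.exp (ρ * w) + L * X‖ ≤ ‖w‖ * Real.exp (ρ * u) + L * X := by
      refine (norm_add_le _ _).trans ?_
      rw [norm_mul, norm_mul, hnE, Complex.norm_real, Complex.norm_real, Real.norm_eq_abs,
        Real.norm_eq_abs, abs_of_pos hX, abs_of_nonneg hL]
    calc _ ≤ (‖w‖ * Real.exp (ρ * u) + L * X) * Real.sin θ := by gcongr
      _ = ‖w‖ * (Real.sin θ * Real.exp (ρ * u)) + L * (Real.sin θ * X) := by ring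
      _ ≤ ‖w‖ * N + L * N := by
        gcongr
        · exact hl.2
        · exact hl.1
      _ = _ := by ring
  have hq2 : ‖2 * w - (w * Complex.exp (ρ * w) + L * X) / (Complex.exp (ρ * w) + X)‖ ≤
      3 / Real.sin θ * ((1 + L) * (|u| + Real.pi + 1)) := by
    refine (norm_sub_le _ _).trans ?_
    have e2 : ‖2 * w‖ ≤ 2 * (‖w‖ + L) / Real.sin θ := by
      rw [norm_mul, Complex.norm_ofNat, le_div_iff₀ hs]
      nlinarith [norm_nonneg w, mul_le_mul_of_nonneg_left hs1 (norm_nonneg w)]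
    have e3 : ‖w‖ + L ≤ (1 + L) * (|u| + Real.pi + 1) := by
      nlinarith [abs_nonneg u, mul_nonneg hL (abs_nonneg u), mul_nonneg hL hp.le]
    calc _ ≤ 2 * (‖w‖ + L) / Real.sin θ + (‖w‖ + L) / Real.sin θ := add_le_add e2 hq
      _ = 3 / Real.sin θ * (‖w‖ + L) := by ring
      _ ≤ _ := by gcongr
  rw [norm_mul]
  calc _ ≤ ((Real.sin θ * X)⁻¹ * (Real.exp (Real.cos θ * Real.exp u + 1 * u) +
        Real.exp (Real.cos θ * Real.exp u + 3 * u))) *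
        (3 / Real.sin θ * ((1 + L) * (|u| + Real.pi + 1))) := by
        refine mul_le_mul (hG.trans ?_) hq2 (norm_nonneg _) (by positivity)
        gcongr
    _ = _ := by
        unfold mlM
        field_simp

lemma mlS_deriv (θ : ℝ) (h1 : Real.pi / 2 < θ) (h2 : θ < Real.pi) (ρ lam L : ℝ)
    (hρ0 : 0 < ρ) (hρ1 : ρ < 1) (hlam : 0 < lam) (hL : 0 ≤ L) :
    ∃ S' : ℂ, HasDerivAt (fun r : ℝ => ∫ u : ℝ, mlG r (lam * Real.exp (L * r)) (u + θ * Complex.I))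
      S' ρ ∧ ‖S'‖ ≤ 3 / Real.sin θ ^ 2 * (1 + L) / (lam * Real.exp (L * ρ)) * ∫ u, mlM θ u := by
  have hκ : 0 < -Real.cos θ := by
    have := Real.cos_neg_of_pi_div_two_lt_of_lt h1 (by linarith)
    linarith
  have hp := Real.pi_pos
  have hs : 0 < Real.sin θ := Real.sin_pos_of_pos_of_lt_pi (by linarith) h2
  have hmem : Ioo (0 : ℝ) 1 ∈ 𝓝 ρ := Ioo_mem_nhds hρ0 hρ1
  have hXp : ∀ r : ℝ, 0 < lam * Real.exp (L * r) := fun r => by positivity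
  have hM := mlM_integrable θ hκ
  have h := hasDerivAt_integral_of_dominated_loc_of_deriv_le (μ := volume) (x₀ := ρ) (𝕜 := ℝ)
    (F := fun (r u : ℝ) => mlG r (lam * Real.exp (L * r)) (u + θ * Complex.I))
    (F' := fun (r u : ℝ) => mlG' r L (lam * Real.exp (L * r)) (u + θ * Complex.I))
    (bound := fun u => 3 / Real.sin θ ^ 2 * (1 + L) / lam * mlM θ u) hmem
    (by
      filter_upwards [hmem] with r hr
      exact (mlG_continuous θ h1 h2 r _ hr.1 hr.2.le (hXp r)).aestronglyMeasurable)
    (mlG_integrable θ h1 h2 ρ _ hρ0 hρ1.le (hXp ρ))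
    (by
      apply Continuous.aestronglyMeasurable
      unfold mlG'
      refine (mlG_continuous θ h1 h2 ρ _ hρ0 hρ1.le (hXp ρ)).mul ?_
      refine Continuous.sub (by fun_prop) (Continuous.div (by fun_prop) (by fun_prop) fun u => ?_)
      apply mlF_ne θ h1 h2 ρ _ hρ0 hρ1.le (hXp ρ)
      simp [abs_of_pos (show 0 < θ by linarith)])
    (Eventually.of_forall fun u r hr => by
      refine (mlG'_norm θ h1 h2 r L _ u hr.1 hr.2.le (hXp r) hL).trans ?_
      have : lam ≤ lam * Real.exp (L * r) := by
        have : 1 ≤ Real.exp (L * r) := Real.one_le_exp (mul_nonneg hL hr.1.le)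
        nlinarith
      have := mlM_nonneg θ u
      gcongr)
    (hM.const_mul _)
    (Eventually.of_forall fun u r hr => mlG_hasDerivAt θ h1 h2 r lam L u hr.1 hr.2.le hlam)
  refine ⟨_, h.2, ?_⟩
  rw [← integral_const_mul]
  exact norm_integral_le_of_norm_le (hM.const_mul _)
    (Eventually.of_forall fun u => mlG'_norm θ h1 h2 ρ L _ u hρ0 hρ1.le (hXp ρ) hL)

lemma mlS_norm (θ : ℝ) (h1 : Real.pi / 2 < θ) (h2 : θ < Real.pi) (ρ X : ℝ)
    (hρ0 : 0 < ρ) (hρ1 : ρ < 1) (hX : 0 < X) :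
    ‖∫ u : ℝ, mlG ρ X (u + θ * Complex.I)‖ ≤ 1 / Real.sin θ ^ 2 / X * ∫ u, mlM θ u := by
  have hκ : 0 < -Real.cos θ := by
    have := Real.cos_neg_of_pi_div_two_lt_of_lt h1 (by linarith)
    linarith
  have hp := Real.pi_pos
  have hs : 0 < Real.sin θ := Real.sin_pos_of_pos_of_lt_pi (by linarith) h2
  have hθ : |θ| ≤ θ := by rw [abs_of_pos (by linarith)]
  rw [← integral_const_mul]
  refine norm_integral_le_of_norm_le ((mlM_integrable θ hκ).const_mul _)
    (Eventually.of_forall fun u => ?_)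
  refine (mlG_norm θ h1 h2 ρ X u θ hρ0 hρ1.le hX hθ).trans ?_
  have e1 : (Real.sin θ * X)⁻¹ ≤ 1 / Real.sin θ ^ 2 / X := by
    rw [div_div, ← one_div]
    have := Real.sin_le_one θ
    apply one_div_le_one_div_of_le (by positivity)
    nlinarith [mul_pos hs hX]
  have e2 : Real.exp (Real.cos θ * Real.exp u + (1 + 2 * ρ) * u) ≤ mlM θ u := by
    refine (ml_exp_le_mlM θ ρ u hρ0 hρ1.le).trans ?_
    unfold mlM
    apply le_mul_of_one_le_right (by positivity)
    linarith [abs_nonneg u]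
  exact mul_le_mul e1 e2 (Real.exp_pos _).le (by positivity)

lemma ml_g (ρ₀ : ℝ) (h0 : 0 < ρ₀) :
    ∃ K : ℝ, 0 ≤ K ∧ ∀ ρ ∈ Ico ρ₀ 1, ρ₀ * (1 - ρ) ≤ -1 / Real.Gamma (-ρ) ∧
      ∃ g' : ℝ, HasDerivAt (fun r : ℝ => -1 / Real.Gamma (-r)) g' ρ ∧ g' + 1 ≤ K * (1 - ρ) := by
  let Hc : ℂ → ℂ := fun z => z * (Complex.Gamma (2 - z))⁻¹
  have hHc : Differentiable ℂ Hc := by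
    have : Differentiable ℂ fun z : ℂ => (Complex.Gamma (2 - z))⁻¹ :=
      Complex.differentiable_one_div_Gamma.comp (by fun_prop : Differentiable ℂ fun z : ℂ => 2 - z)
    exact differentiable_id.mul this
  have hcd : Continuous (deriv Hc) := (hHc.contDiff (n := 1)).continuous_deriv le_rfl
  have hval : ∀ r : ℝ, (Hc r).re = r / Real.Gamma (2 - r) := by
    intro r
    have : Hc r = ((r / Real.Gamma (2 - r) : ℝ) : ℂ) := by
      simp only [Hc]
      rw [show (2 - r : ℂ) = ((2 - r : ℝ) : ℂ) by push_cast; ring, Complex.Gamma_ofReal]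
      push_cast
      rw [div_eq_mul_inv]
    rw [this, Complex.ofReal_re]
  have hder : ∀ r : ℝ, HasDerivAt (fun r : ℝ => r / Real.Gamma (2 - r)) (deriv Hc r).re r := by
    intro r
    have := (hHc r).hasDerivAt.real_of_complex
    simpa only [hval] using this
  obtain ⟨K, hK⟩ := (isCompact_Icc (a := ρ₀) (b := 1)).exists_bound_of_continuousOn
    (f := fun r : ℝ => (deriv Hc r).re)
    (Complex.continuous_re.comp (hcd.comp Complex.continuous_ofReal)).continuousOn
  refine ⟨2 * |K|, by positivity, ?_⟩
  intro ρ hρ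
  have hρ1 := hρ.2
  have hρ0 : 0 < ρ := h0.trans_le hρ.1
  have hK' : ∀ r ∈ Icc ρ₀ 1, ‖(deriv Hc r).re‖ ≤ |K| := fun r hr => (hK r hr).trans (le_abs_self K)
  have hid : ∀ r ∈ Ioo (0 : ℝ) 1, -1 / Real.Gamma (-r) = (1 - r) * (r / Real.Gamma (2 - r)) := by
    intro r hr
    have e1 : Real.Gamma (2 - r) = (1 - r) * Real.Gamma (1 - r) := by
      rw [show 2 - r = (1 - r) + 1 by ring, Real.Gamma_add_one (by linarith [hr.2])]
    have e2 : Real.Gamma (1 - r) = (-r) * Real.Gamma (-r) := by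
      rw [show 1 - r = (-r) + 1 by ring, Real.Gamma_add_one (by linarith [hr.1])]
    have hp : Real.Gamma (1 - r) ≠ 0 := (Real.Gamma_pos_of_pos (by linarith [hr.2])).ne'
    have hn : Real.Gamma (-r) ≠ 0 := by
      intro h; rw [h, mul_zero] at e2; exact hp e2
    have : (1 - r) ≠ 0 := by linarith [hr.2]
    have : r ≠ 0 := hr.1.ne'
    rw [e1, e2]
    field_simp
  have hG1 : Real.Gamma (2 - ρ) ≤ 1 := by
    have := Real.convexOn_Gamma.le_max_of_mem_Icc (x := 1) (y := 2) (z := 2 - ρ)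
      (by simp) (by simp) ⟨by linarith, by linarith⟩
    simpa [Real.Gamma_two] using this
  have hGp : 0 < Real.Gamma (2 - ρ) := Real.Gamma_pos_of_pos (by linarith)
  constructor
  · rw [hid ρ ⟨hρ0, hρ1⟩]
    have : ρ₀ ≤ ρ / Real.Gamma (2 - ρ) := by
      rw [le_div_iff₀ hGp]
      nlinarith [hρ.1]
    nlinarith
  · refine ⟨_, (((hasDerivAt_id ρ).const_sub 1).mul (hder ρ)).congr_of_eventuallyEq ?_, ?_⟩
    · filter_upwards [Ioo_mem_nhds hρ0 hρ1] with r hr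
      simpa using hid r hr
    · have hmv := Convex.norm_image_sub_le_of_norm_hasDerivWithin_le
        (fun r _ => (hder r).hasDerivWithinAt) hK' (convex_Icc ρ₀ 1)
        (x := ρ) (y := 1) ⟨hρ.1, hρ1.le⟩ ⟨by linarith [hρ.1], le_rfl⟩
      have h11 : (1 : ℝ) / Real.Gamma (2 - 1) = 1 := by norm_num
      rw [h11, Real.norm_eq_abs, Real.norm_eq_abs, abs_of_pos (show 0 < 1 - ρ by linarith)] at hmv
      have hb := hK' ρ ⟨hρ.1, hρ1.le⟩
      have b1 := (abs_le.1 hmv).2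
      have b2 := (abs_le.1 (by simpa using hb : |(deriv Hc ρ).re| ≤ |K|)).2
      simp only [id]
      nlinarith

lemma ml_e_eq (θ : ℝ) (h1 : Real.pi / 2 < θ) (h2 : θ < Real.pi) (r lam t : ℝ)
    (hr0 : 0 < r) (hr1 : r < 1) (hlam : 0 < lam) (ht : 0 < t) :
    t ^ (r - 1) * mittagLeffler r r (-(lam * t ^ r)) =
      lam⁻¹ ^ 2 * Real.exp (-(Real.log t * (r + 1))) * (-1 / Real.Gamma (-r) +
      (∫ u : ℝ, mlG r (lam * Real.exp (Real.log t * r)) (u + θ * Complex.I)).im / Real.pi) := by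
  rw [Real.rpow_def_of_pos ht, Real.rpow_def_of_pos ht,
    ml_rep2 θ h1 h2 r _ hr0 hr1.le (by positivity), ← mul_assoc]
  congr 1
  rw [mul_inv, mul_pow, ← Real.exp_neg, ← Real.exp_nat_mul, mul_left_comm, ← Real.exp_add]
  congr 2
  push_cast
  ring

/-- Let `γ` be the Euler–Mascheroni constant. For every `ρ₀ ∈ (0,1)` and `λ₁ > 0` there
exist `C > 0` and `T₀ ≥ e^{1-γ} e^{2/ρ₀}` such that for all `t₀ ≥ T₀`, `λ ≥ λ₁` and
`ρ ∈ [ρ₀, 1)`, the function `e_λ(ρ) = t₀^{ρ-1} E_{ρ,ρ}(-λ t₀^ρ)` is differentiable at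
`ρ` with `e_λ'(ρ) ≤ -1/(λ² t₀^{ρ+1}) + C (1/ρ + ln t₀)/(λ³ t₀^{2ρ+1})`; consequently, if
moreover `t₀^{ρ₀} > (C/λ₁)(1/ρ₀ + ln t₀)`, then `e_λ'(ρ) < 0`. -/
theorem statement15 (ρ₀ : ℝ) (hρ₀ : ρ₀ ∈ Set.Ioo (0 : ℝ) 1) (lam₁ : ℝ) (hlam₁ : 0 < lam₁) :
    ∃ C : ℝ, 0 < C ∧ ∃ T₀ : ℝ,
      Real.exp (1 - Real.eulerMascheroniConstant) * Real.exp (2 / ρ₀) ≤ T₀ ∧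
      ∀ t₀ : ℝ, T₀ ≤ t₀ → ∀ lam : ℝ, lam₁ ≤ lam → ∀ ρ ∈ Set.Ico ρ₀ 1,
        DifferentiableAt ℝ
          (fun r : ℝ => t₀ ^ (r - 1) * mittagLeffler r r (-(lam * t₀ ^ r))) ρ ∧
        deriv (fun r : ℝ => t₀ ^ (r - 1) * mittagLeffler r r (-(lam * t₀ ^ r))) ρ ≤
          -1 / (lam ^ 2 * t₀ ^ (ρ + 1)) +
            C * (1 / ρ + Real.log t₀) / (lam ^ 3 * t₀ ^ (2 * ρ + 1)) ∧
        (t₀ ^ ρ₀ > (C / lam₁) * (1 / ρ₀ + Real.log t₀) →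
          deriv (fun r : ℝ => t₀ ^ (r - 1) * mittagLeffler r r (-(lam * t₀ ^ r))) ρ < 0) := by
  obtain ⟨h0, h01⟩ := hρ₀
  obtain ⟨K, hK0, hK⟩ := ml_g ρ₀ h0
  have hp := Real.pi_pos
  obtain ⟨θ, h1, h2⟩ : ∃ θ : ℝ, Real.pi / 2 < θ ∧ θ < Real.pi :=
    ⟨2 * Real.pi / 3, by linarith, by linarith⟩
  have hs : 0 < Real.sin θ := Real.sin_pos_of_pos_of_lt_pi (by linarith) h2
  have hB : 0 ≤ ∫ u, mlM θ u := integral_nonneg (mlM_nonneg θ)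
  set B := ∫ u, mlM θ u with hBdef
  set D := B / Real.sin θ ^ 2 with hD
  have hD0 : 0 ≤ D := by positivity
  refine ⟨4 * D + 1, by positivity, max (Real.exp (1 - Real.eulerMascheroniConstant) *
    Real.exp (2 / ρ₀)) (Real.exp (K / ρ₀)), le_max_left _ _, ?_⟩
  intro t ht lam hlam1 ρ hρ
  have hlam : 0 < lam := hlam₁.trans_le hlam1
  have hρ0 : 0 < ρ := h0.trans_le hρ.1
  have hρ1 : ρ < 1 := hρ.2
  have htK : Real.exp (K / ρ₀) ≤ t := (le_max_right _ _).trans ht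
  have ht0 : 0 < t := (Real.exp_pos _).trans_le htK
  have hLK : K / ρ₀ ≤ Real.log t := (Real.le_log_iff_exp_le ht0).2 htK
  have hL0 : 0 ≤ Real.log t := le_trans (by positivity) hLK
  set L := Real.log t with hLdef
  obtain ⟨hg, g', hg', hgK⟩ := hK ρ hρ
  obtain ⟨S', hS', hS'n⟩ := mlS_deriv θ h1 h2 ρ lam L hρ0 hρ1 hlam hL0
  set X := lam * Real.exp (L * ρ) with hXdef
  have hX : 0 < X := by positivity
  have hSn := mlS_norm θ h1 h2 ρ X hρ0 hρ1 hX
  have hSim : HasDerivAt (fun r : ℝ =>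
      (∫ u : ℝ, mlG r (lam * Real.exp (L * r)) (u + θ * Complex.I)).im) S'.im ρ :=
    Complex.imCLM.hasFDerivAt.comp_hasDerivAt ρ hS'
  have hexp : HasDerivAt (fun r : ℝ => lam⁻¹ ^ 2 * Real.exp (-(L * (r + 1))))
      (lam⁻¹ ^ 2 * (Real.exp (-(L * (ρ + 1))) * (-L))) ρ := by
    have := ((((hasDerivAt_id ρ).add_const 1).const_mul L).neg.exp).const_mul (lam⁻¹ ^ 2)
    simpa using this
  have hder := (hexp.mul (hg'.add (hSim.div_const Real.pi)))
  have hder2 := hder.congr_of_eventuallyEq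
    (f₁ := fun r : ℝ => t ^ (r - 1) * mittagLeffler r r (-(lam * t ^ r))) (by
      filter_upwards [Ioo_mem_nhds hρ0 hρ1] with r hr
      exact ml_e_eq θ h1 h2 r lam t hr.1 hr.2 hlam ht0)
  have hbound : deriv (fun r : ℝ => t ^ (r - 1) * mittagLeffler r r (-(lam * t ^ r))) ρ ≤
      -1 / (lam ^ 2 * t ^ (ρ + 1)) +
        (4 * D + 1) * (1 / ρ + L) / (lam ^ 3 * t ^ (2 * ρ + 1)) := by
    rw [hder2.deriv]
    simp only [Pi.add_apply]
    rw [← hXdef]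
    set S := ∫ u : ℝ, mlG ρ X (u + θ * Complex.I) with hSdef
    set g := -1 / Real.Gamma (-ρ) with hgdef
    set Q := lam⁻¹ ^ 2 * Real.exp (-(L * (ρ + 1))) with hQdef
    have hQ : 0 < Q := by positivity
    have q1 : -1 / (lam ^ 2 * t ^ (ρ + 1)) = -Q := by
      rw [Real.rpow_def_of_pos ht0, hQdef, Real.exp_neg, ← hLdef]
      field_simp
    have q2 : (4 * D + 1) * (1 / ρ + L) / (lam ^ 3 * t ^ (2 * ρ + 1)) =
        Q * ((4 * D + 1) * (1 / ρ + L) / X) := by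
      rw [Real.rpow_def_of_pos ht0, hQdef, Real.exp_neg, ← hLdef, hXdef,
        show L * (2 * ρ + 1) = L * (ρ + 1) + L * ρ by ring, Real.exp_add]
      field_simp
    rw [q1, q2]
    have hkey : g' + S'.im / Real.pi - L * (g + S.im / Real.pi) ≤
        -1 + (4 * D + 1) * (1 / ρ + L) / X := by
      have a1 : g' - L * g ≤ -1 := by
        have : K ≤ L * ρ₀ := (div_le_iff₀ h0).1 hLK
        nlinarith [mul_le_mul_of_nonneg_left hg hL0,
          mul_le_mul_of_nonneg_right this (show 0 ≤ 1 - ρ by linarith)]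
      have dp : ∀ y : ℝ, |y / Real.pi| ≤ |y| := by
        intro y
        rw [abs_div, abs_of_pos hp]
        exact div_le_self (abs_nonneg y) (by linarith [Real.pi_gt_three])
      have a2 : S'.im / Real.pi ≤ 3 * D * (1 + L) / X := by
        refine (le_abs_self _).trans ((dp _).trans ((Complex.abs_im_le_norm _).trans
          (hS'n.trans (le_of_eq ?_))))
        rw [hD]; ring
      have a3 : -(S.im / Real.pi) ≤ D / X := by
        refine (neg_le_abs _).trans ((dp _).trans ((Complex.abs_im_le_norm _).trans
          (hSn.trans (le_of_eq ?_))))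
        rw [hD]; ring
      have a4 : L * -(S.im / Real.pi) ≤ L * (D / X) := mul_le_mul_of_nonneg_left a3 hL0
      have a5 : 3 * D * (1 + L) / X + L * (D / X) ≤ (4 * D + 1) * (1 / ρ + L) / X := by
        rw [← mul_div_assoc L D X, ← add_div]
        have : 1 ≤ 1 / ρ := by rw [le_div_iff₀ hρ0]; linarith
        apply div_le_div_of_nonneg_right _ hX.le
        nlinarith [mul_nonneg hD0 hL0, mul_le_mul_of_nonneg_left this hD0]
      linarith
    have := mul_le_mul_of_nonneg_left hkey hQ.le
    have e : lam⁻¹ ^ 2 * (Real.exp (-(L * (ρ + 1))) * (-L)) = Q * (-L) := by rw [hQdef]; ring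
    rw [e]
    linarith
  refine ⟨hder2.differentiableAt, hbound, fun hcond => lt_of_le_of_lt hbound ?_⟩
  have ht1 : 1 ≤ t := by
    have : 1 ≤ Real.exp (K / ρ₀) := Real.one_le_exp (by positivity)
    linarith
  have hC : 0 < 4 * D + 1 := by positivity
  have c1 : (4 * D + 1) * (1 / ρ₀ + L) < t ^ ρ₀ * lam₁ := by
    have : (4 * D + 1) / lam₁ * (1 / ρ₀ + L) = (4 * D + 1) * (1 / ρ₀ + L) / lam₁ := by ring
    rw [gt_iff_lt, this, div_lt_iff₀ hlam₁] at hcond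
    exact hcond
  have c2 : t ^ ρ₀ * lam₁ ≤ t ^ ρ * lam :=
    mul_le_mul (Real.rpow_le_rpow_of_exponent_le ht1 hρ.1) hlam1 hlam₁.le
      (Real.rpow_nonneg ht0.le _)
  have c3 : (4 * D + 1) * (1 / ρ + L) ≤ (4 * D + 1) * (1 / ρ₀ + L) := by
    have : 1 / ρ ≤ 1 / ρ₀ := one_div_le_one_div_of_le h0 hρ.1
    gcongr
  have c4 : lam ^ 3 * t ^ (2 * ρ + 1) = (lam ^ 2 * t ^ (ρ + 1)) * (t ^ ρ * lam) := by
    rw [show 2 * ρ + 1 = (ρ + 1) + ρ by ring, Real.rpow_add ht0]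
    ring
  have hA : 0 < lam ^ 2 * t ^ (ρ + 1) := by positivity
  have hY : 0 < t ^ ρ * lam := by positivity
  have e5 : -1 / (lam ^ 2 * t ^ (ρ + 1)) +
      (4 * D + 1) * (1 / ρ + L) / (lam ^ 3 * t ^ (2 * ρ + 1)) =
      (-1 + (4 * D + 1) * (1 / ρ + L) / (t ^ ρ * lam)) / (lam ^ 2 * t ^ (ρ + 1)) := by
    rw [c4, add_div, div_div, mul_comm (t ^ ρ * lam)]
  rw [e5]
  apply div_neg_of_neg_of_pos _ hA
  have : (4 * D + 1) * (1 / ρ + L) / (t ^ ρ * lam) < 1 := by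
    rw [div_lt_one hY]
    linarith
  linarith
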